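/- arXiv:2208.13637 — 2 statements merged into one kernel-verified Lean document; each statement's English description precedes it below -/
import Mathlib

section
/- Let G be a generalized (m,n)-ladder graph. If there is an edge a ∈ [G₁,G₂] such that all four sets L↑(a) ∩ R↓(a), L↑(a) ∩ R↑(a), L↓(a) ∩ R↑(a), L↓(a) ∩ R↓(a) are nonempty, then G contains a subdivision of K_{3,3}. -/
open SimpleGraph

/-- `G` contains a subdivision of `H`: there is an injection `f` of the vertices of `H`
into the vertices of `G` and, for each edge of `H`, a path in `G` between the images of its
endpoints, such that the paths pass through no branch vertices other than their own endpoints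
and paths corresponding to distinct edges are internally disjoint. -/
def ContainsSubdivision {V W : Type*} (G : SimpleGraph V) (H : SimpleGraph W) : Prop :=
  ∃ f : W → V, Function.Injective f ∧
    ∃ p : ∀ ⦃a b : W⦄, H.Adj a b → G.Walk (f a) (f b),
      (∀ ⦃a b : W⦄ (h : H.Adj a b), (p h).IsPath) ∧
      (∀ ⦃a b : W⦄ (h : H.Adj a b) (w : W), f w ∈ (p h).support → w = a ∨ w = b) ∧
      (∀ ⦃a b a' b' : W⦄ (h : H.Adj a b) (h' : H.Adj a' b'), s(a, b) ≠ s(a', b') →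
        ∀ v, v ∈ (p h).support → v ∈ (p h').support →
          (v = f a ∨ v = f b) ∧ (v = f a' ∨ v = f b'))

/-- A graph is planar iff it contains no subdivision of `K₅` or `K₃,₃` (Kuratowski). -/
def IsPlanar {V : Type*} (G : SimpleGraph V) : Prop :=
  ¬ ContainsSubdivision G (completeGraph (Fin 5)) ∧
  ¬ ContainsSubdivision G (completeBipartiteGraph (Fin 3) (Fin 3))

/-- A graph is outerplanar iff it contains no subdivision of `K₄` or `K₃,₂`
(Chartrand–Harary). -/
def IsOuterplanar {V : Type*} (G : SimpleGraph V) : Prop :=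
  ¬ ContainsSubdivision G (completeGraph (Fin 4)) ∧
  ¬ ContainsSubdivision G (completeBipartiteGraph (Fin 3) (Fin 2))

/-- The base relation of a generalized (m,n)-ladder graph: consecutive vertices on each of the
two paths are adjacent, and `u i` is adjacent to `v j` exactly when `(i, j)` is a cross edge. -/
def ladderRel (m n : ℕ) (cross : Finset (Fin m × Fin n)) :
    Fin m ⊕ Fin n → Fin m ⊕ Fin n → Prop
  | Sum.inl i, Sum.inl j => (i : ℕ) + 1 = (j : ℕ)
  | Sum.inr i, Sum.inr j => (i : ℕ) + 1 = (j : ℕ)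
  | Sum.inl i, Sum.inr j => (i, j) ∈ cross
  | Sum.inr _, Sum.inl _ => False

/-- The generalized (m,n)-ladder graph determined by the set `cross` of cross edges
`[G₁, G₂]`.  Vertices `Sum.inl i` are the vertices `u_{i+1}` of the path `G₁` and
vertices `Sum.inr j` are the vertices `v_{j+1}` of the path `G₂`. -/
def ladderGraph (m n : ℕ) (cross : Finset (Fin m × Fin n)) :
    SimpleGraph (Fin m ⊕ Fin n) :=
  SimpleGraph.fromRel (ladderRel m n cross)

/-- `L↑(e)`: the cross edges `e'` with `l(e) < l(e')`. -/
def Lup {m n : ℕ} (cross : Finset (Fin m × Fin n)) (e : Fin m × Fin n) :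
    Finset (Fin m × Fin n) := cross.filter fun e' => e.1 < e'.1

/-- `L↓(e)`: the cross edges `e'` with `l(e') < l(e)`. -/
def Ldown {m n : ℕ} (cross : Finset (Fin m × Fin n)) (e : Fin m × Fin n) :
    Finset (Fin m × Fin n) := cross.filter fun e' => e'.1 < e.1

/-- `R↑(e)`: the cross edges `e'` with `r(e) < r(e')`. -/
def Rup {m n : ℕ} (cross : Finset (Fin m × Fin n)) (e : Fin m × Fin n) :
    Finset (Fin m × Fin n) := cross.filter fun e' => e.2 < e'.2

/-- `R↓(e)`: the cross edges `e'` with `r(e') < r(e)`. -/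
def Rdown {m n : ℕ} (cross : Finset (Fin m × Fin n)) (e : Fin m × Fin n) :
    Finset (Fin m × Fin n) := cross.filter fun e' => e'.2 < e.2

/-- There is a walk from `a` to `b` in `G` all of whose vertices lie in `S`. -/
def WalkWithin {V : Type*} (G : SimpleGraph V) (S : Set V) (a b : V) : Prop :=
  ∃ p : G.Walk a b, ∀ v ∈ p.support, v ∈ S

namespace WalkWithin

variable {V : Type*} {G : SimpleGraph V} {S : Set V} {a b c : V}

lemma refl (h : a ∈ S) : WalkWithin G S a a :=
  ⟨.nil, by simpa using h⟩

lemma symm (h : WalkWithin G S a b) : WalkWithin G S b a := by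
  obtain ⟨p, hp⟩ := h
  exact ⟨p.reverse, by simpa using hp⟩

lemma trans (h : WalkWithin G S a b) (h' : WalkWithin G S b c) : WalkWithin G S a c := by
  obtain ⟨p, hp⟩ := h
  obtain ⟨q, hq⟩ := h'
  refine ⟨p.append q, fun v hv => ?_⟩
  rcases Walk.mem_support_append_iff _ _ |>.1 hv with hv | hv
  exacts [hp v hv, hq v hv]

lemma of_adj (h : G.Adj a b) (ha : a ∈ S) (hb : b ∈ S) : WalkWithin G S a b :=
  ⟨.cons h .nil, by simp [ha, hb]⟩

lemma exists_isPath (h : WalkWithin G S a b) :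
    ∃ p : G.Walk a b, p.IsPath ∧ ∀ v ∈ p.support, v ∈ S := by
  classical
  obtain ⟨p, hp⟩ := h
  exact ⟨p.bypass, p.bypass_isPath, fun v hv => hp v (p.support_bypass_subset_support hv)⟩

/-- A sequence of consecutively adjacent vertices is traversed by a walk. -/
lemma of_sequence {k : ℕ} {φ : Fin k → V}
    (hφ : ∀ i j : Fin k, (i : ℕ) + 1 = j → G.Adj (φ i) (φ j)) {i j : Fin k} (hij : i ≤ j)
    (hS : ∀ t, i ≤ t → t ≤ j → φ t ∈ S) : WalkWithin G S (φ i) (φ j) := by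
  obtain ⟨j, hj⟩ := j
  induction j with
  | zero =>
    obtain rfl : i = ⟨0, hj⟩ := by ext; exact Nat.le_zero.1 hij
    exact refl (hS _ le_rfl le_rfl)
  | succ j ih =>
    rcases hij.eq_or_lt with rfl | hlt
    · exact refl (hS _ le_rfl le_rfl)
    · have hle : i ≤ ⟨j, by omega⟩ := Nat.le_of_lt_succ hlt
      refine (ih (by omega) hle fun t h1 h2 => hS t h1 (h2.trans (Nat.le_succ j))).trans
        (of_adj (hφ _ _ rfl) (hS _ hle (Nat.le_succ j)) (hS _ hij le_rfl))

end WalkWithin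

/-- A subdivision of a complete bipartite graph is given by walks inside sets that meet only in
common branch vertices. -/
lemma containsSubdivision_completeBipartiteGraph {V A B : Type*} [Nonempty A] [Nonempty B]
    {G : SimpleGraph V} (f : A → V) (g : B → V) (S : A → B → Set V)
    (hfg : ∀ i j, f i ≠ g j) (hS : ∀ i j, WalkWithin G (S i j) (f i) (g j))
    (hdisj : ∀ i j i' j', (i, j) ≠ (i', j') → ∀ v ∈ S i j, v ∈ S i' j' →
      i = i' ∧ v = f i ∨ j = j' ∧ v = g j) :
    ContainsSubdivision G (completeBipartiteGraph A B) := by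
  choose P hP hPS using fun i j => (hS i j).exists_isPath
  have hf : ∀ i j i', f i' ∈ S i j → i' = i := by
    intro i j i' h
    by_contra hne
    have := hdisj i j i' j (by simp [Ne.symm hne]) _ h (hPS i' j _ (Walk.start_mem_support _))
    have := hfg i' j
    grind
  have hg : ∀ i j j', g j' ∈ S i j → j' = j := by
    intro i j j' h
    by_contra hne
    have := hdisj i j i j' (by simp [Ne.symm hne]) _ h (hPS i j' _ (Walk.end_mem_support _))
    have := hfg i j'
    grind
  have hfi : Function.Injective f := fun i i' h => by
    obtain ⟨j⟩ := ‹Nonempty B›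
    exact hf i' j i (h ▸ hPS i' j _ (Walk.start_mem_support _))
  have hgi : Function.Injective g := fun j j' h => by
    obtain ⟨i⟩ := ‹Nonempty A›
    exact hg i j' j (h ▸ hPS i j' _ (Walk.end_mem_support _))
  obtain ⟨Q, hQ⟩ : ∃ Q : ∀ ⦃a b : A ⊕ B⦄, (completeBipartiteGraph A B).Adj a b →
      G.Walk (Sum.elim f g a) (Sum.elim f g b), ∀ a b (h : (completeBipartiteGraph A B).Adj a b),
      (Q h).IsPath ∧ ∀ v ∈ (Q h).support, ∃ i j, v ∈ S i j ∧
        (a = .inl i ∧ b = .inr j ∨ a = .inr j ∧ b = .inl i) := by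
    refine ⟨fun a b h => match a, b, h with
      | .inl i, .inr j, _ => P i j
      | .inr j, .inl i, _ => (P i j).reverse
      | .inl i, .inl j, h => absurd h (by simp)
      | .inr i, .inr j, h => absurd h (by simp), ?_⟩
    rintro (i | i) (j | j) h
    · simp at h
    · exact ⟨hP i j, fun v hv => ⟨i, j, hPS i j v hv, .inl ⟨rfl, rfl⟩⟩⟩
    · refine ⟨(hP j i).reverse, fun v hv => ⟨j, i, hPS j i v ?_, .inr ⟨rfl, rfl⟩⟩⟩
      exact List.mem_reverse.1 (Walk.support_reverse (P j i) ▸ hv)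
    · simp at h
  refine ⟨Sum.elim f g, hfi.sumElim hgi hfg, Q, fun a b h => (hQ a b h).1, ?_, ?_⟩
  · intro a b h w hw
    obtain ⟨i, j, hv, hab⟩ := (hQ a b h).2 _ hw
    rcases w with w | w
    · obtain rfl := hf _ _ _ hv
      tauto
    · obtain rfl := hg _ _ _ hv
      tauto
  · intro a b a' b' h h' hne v hv hv'
    obtain ⟨i, j, hv, hab⟩ := (hQ a b h).2 v hv
    obtain ⟨i', j', hv', hab'⟩ := (hQ a' b' h').2 v hv'
    have hij : (i, j) ≠ (i', j') := by
      rintro ⟨⟩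
      rcases hab with ⟨rfl, rfl⟩ | ⟨rfl, rfl⟩ <;> rcases hab' with ⟨rfl, rfl⟩ | ⟨rfl, rfl⟩ <;>
        simp [Sym2.eq_swap] at hne
    have := hdisj i j i' j' hij v hv hv'
    rcases hab with ⟨rfl, rfl⟩ | ⟨rfl, rfl⟩ <;> rcases hab' with ⟨rfl, rfl⟩ | ⟨rfl, rfl⟩ <;>
      simp only [Sum.elim_inl, Sum.elim_inr] <;> grind

section Ladder

variable {m n : ℕ} {cross : Finset (Fin m × Fin n)} {S : Set (Fin m ⊕ Fin n)}

lemma ladderGraph_adj_inl (i j : Fin m) (h : (i : ℕ) + 1 = j) :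
    (ladderGraph m n cross).Adj (.inl i) (.inl j) := by
  simp only [ladderGraph, SimpleGraph.fromRel_adj, ladderRel, ne_eq, Sum.inl.injEq, Fin.ext_iff]
  omega

lemma ladderGraph_adj_inr (i j : Fin n) (h : (i : ℕ) + 1 = j) :
    (ladderGraph m n cross).Adj (.inr i) (.inr j) := by
  simp only [ladderGraph, SimpleGraph.fromRel_adj, ladderRel, ne_eq, Sum.inr.injEq, Fin.ext_iff]
  omega

lemma ladderGraph_adj_inl_inr {i : Fin m} {j : Fin n} (h : (i, j) ∈ cross) :
    (ladderGraph m n cross).Adj (.inl i) (.inr j) := by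
  simp [ladderGraph, ladderRel, h]

lemma walkWithin_inl {i j a b : Fin m} (hi : i ∈ Set.Icc a b) (hj : j ∈ Set.Icc a b)
    (hS : ∀ t ∈ Set.Icc a b, .inl t ∈ S) :
    WalkWithin (ladderGraph m n cross) S (.inl i) (.inl j) := by
  rcases le_total i j with h | h
  · exact .of_sequence ladderGraph_adj_inl h
      fun t h1 h2 => hS t ⟨hi.1.trans h1, h2.trans hj.2⟩
  · exact (WalkWithin.of_sequence ladderGraph_adj_inl h
      fun t h1 h2 => hS t ⟨hj.1.trans h1, h2.trans hi.2⟩).symm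

lemma walkWithin_inr {i j a b : Fin n} (hi : i ∈ Set.Icc a b) (hj : j ∈ Set.Icc a b)
    (hS : ∀ t ∈ Set.Icc a b, .inr t ∈ S) :
    WalkWithin (ladderGraph m n cross) S (.inr i) (.inr j) := by
  rcases le_total i j with h | h
  · exact .of_sequence ladderGraph_adj_inr h
      fun t h1 h2 => hS t ⟨hi.1.trans h1, h2.trans hj.2⟩
  · exact (WalkWithin.of_sequence ladderGraph_adj_inr h
      fun t h1 h2 => hS t ⟨hj.1.trans h1, h2.trans hi.2⟩).symm

/-- The vertices of the ladder lying on the segment from `a` to `b` of the left path or on the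
segment from `c` to `d` of the right path. -/
def ladderSegments (a b : Fin m) (c d : Fin n) : Set (Fin m ⊕ Fin n) :=
  Sum.elim (· ∈ Set.Icc a b) (· ∈ Set.Icc c d)

@[simp]
lemma inl_mem_ladderSegments {a b t : Fin m} {c d : Fin n} :
    .inl t ∈ ladderSegments a b c d ↔ a ≤ t ∧ t ≤ b := Iff.rfl

@[simp]
lemma inr_mem_ladderSegments {a b : Fin m} {c d t : Fin n} :
    .inr t ∈ ladderSegments a b c d ↔ c ≤ t ∧ t ≤ d := Iff.rfl

lemma walkWithin_inr_inl {p x a b : Fin m} {q y c d : Fin n} (h : (x, y) ∈ cross)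
    (hp : p ∈ Set.Icc a b) (hx : x ∈ Set.Icc a b) (hq : q ∈ Set.Icc c d)
    (hy : y ∈ Set.Icc c d) :
    WalkWithin (ladderGraph m n cross) (ladderSegments a b c d) (.inr q) (.inl p) := by
  have hqy : WalkWithin (ladderGraph m n cross) (ladderSegments a b c d) (.inr q) (.inr y) :=
    walkWithin_inr hq hy fun _ ht => ht
  have hpx : WalkWithin (ladderGraph m n cross) (ladderSegments a b c d) (.inl p) (.inl x) :=
    walkWithin_inl hp hx fun _ ht => ht
  have hxy : WalkWithin (ladderGraph m n cross) (ladderSegments a b c d) (.inl x) (.inr y) :=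
    .of_adj (ladderGraph_adj_inl_inr h) hx hy
  exact (hpx.trans hxy |>.trans hqy.symm).symm

end Ladder

set_option maxHeartbeats 800000 in
-- The pairwise comparison of the nine segments splits into 81 cases.
/-- If some cross edge `a` has all four of `L↑(a) ∩ R↓(a)`, `L↑(a) ∩ R↑(a)`,
`L↓(a) ∩ R↑(a)`, `L↓(a) ∩ R↓(a)` nonempty, then the generalized ladder graph contains a
subdivision of `K₃,₃`. -/
theorem ladder_containsSubdivision_K33 (m n : ℕ) (hm : 0 < m) (hn : 0 < n)
    (cross : Finset (Fin m × Fin n)) (a : Fin m × Fin n) (ha : a ∈ cross)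
    (h1 : (Lup cross a ∩ Rdown cross a).Nonempty)
    (h2 : (Lup cross a ∩ Rup cross a).Nonempty)
    (h3 : (Ldown cross a ∩ Rup cross a).Nonempty)
    (h4 : (Ldown cross a ∩ Rdown cross a).Nonempty) :
    ContainsSubdivision (ladderGraph m n cross)
      (completeBipartiteGraph (Fin 3) (Fin 3)) := by
  obtain ⟨⟨x1, y1⟩, h1⟩ := h1
  obtain ⟨⟨x2, y2⟩, h2⟩ := h2
  obtain ⟨⟨x3, y3⟩, h3⟩ := h3
  obtain ⟨⟨x4, y4⟩, h4⟩ := h4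
  obtain ⟨u, v⟩ := a
  simp only [Lup, Ldown, Rup, Rdown, Finset.mem_inter, Finset.mem_filter] at h1 h2 h3 h4
  obtain ⟨⟨c1, hx1⟩, -, hy1⟩ := h1
  obtain ⟨⟨c2, hx2⟩, -, hy2⟩ := h2
  obtain ⟨⟨c3, hx3⟩, -, hy3⟩ := h3
  obtain ⟨⟨c4, hx4⟩, -, hy4⟩ := h4
  have hmin : ∀ {k : ℕ} (x y : Fin k), ∃ p, p ≤ x ∧ p ≤ y ∧ (p = x ∨ p = y) := fun x y =>
    ⟨min x y, min_le_left x y, min_le_right x y, min_choice x y⟩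
  have hmax : ∀ {k : ℕ} (x y : Fin k), ∃ p, x ≤ p ∧ y ≤ p ∧ (p = x ∨ p = y) := fun x y =>
    ⟨max x y, le_max_left x y, le_max_right x y, max_choice x y⟩
  obtain ⟨p, hp⟩ := hmin x1 x2
  obtain ⟨p', hp'⟩ := hmax x3 x4
  obtain ⟨q, hq⟩ := hmin y2 y3
  obtain ⟨q', hq'⟩ := hmax y1 y4
  refine containsSubdivision_completeBipartiteGraph ![.inl u, .inr q, .inr q']
    ![.inr v, .inl p, .inl p']
    ![![{.inl u, .inr v}, Sum.inl '' Set.Icc u p, Sum.inl '' Set.Icc p' u],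
      ![Sum.inr '' Set.Icc v q, ladderSegments p x2 q y2, ladderSegments x3 p' q y3],
      ![Sum.inr '' Set.Icc q' v, ladderSegments p x1 y1 q', ladderSegments x4 p' y4 q']] ?_ ?_ ?_
  · intro i j
    fin_cases i <;> fin_cases j <;> simp <;> omega
  · intro i j
    fin_cases i <;> fin_cases j
    · exact .of_adj (ladderGraph_adj_inl_inr ha) (by simp) (by simp)
    · exact walkWithin_inl (by simp; omega) (by simp; omega) fun _ => Set.mem_image_of_mem _
    · exact walkWithin_inl (by simp; omega) (by simp; omega) fun _ => Set.mem_image_of_mem _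
    · exact walkWithin_inr (by simp; omega) (by simp; omega) fun _ => Set.mem_image_of_mem _
    · apply walkWithin_inr_inl c2 <;> simp <;> omega
    · apply walkWithin_inr_inl c3 <;> simp <;> omega
    · exact walkWithin_inr (by simp; omega) (by simp; omega) fun _ => Set.mem_image_of_mem _
    · apply walkWithin_inr_inl c1 <;> simp <;> omega
    · apply walkWithin_inr_inl c4 <;> simp <;> omega
  · clear hmin hmax c1 c2 c3 c4 ha
    intro i j i' j' hne
    fin_cases i <;> fin_cases j <;> fin_cases i' <;> fin_cases j' <;>
      first
      | exact absurd rfl hne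
      | (clear hne; rintro (t | t) <;> simp <;> omega)
end

section
/- Let n be a positive integer and let f : {1,…,n} → {1,…,n} be a function. The functigraph C(P_n, f) is planar if and only if for each i ∈ {1,…,n}, at least one of the following four sets is empty: {j : i < j ≤ n, f(j) < f(i)}, {j : i < j ≤ n, f(j) > f(i)}, {j : 1 ≤ j < i, f(j) > f(i)}, {j : 1 ≤ j < i, f(j) < f(i)}. -/
open SimpleGraph

/-- An algebraic form of the Hanani–Tutte criterion over `ZMod 2`: `T` records the order of the
vertices along a line, `φ v a b` records whether the edge `ab` is pulled across the vertex `v`,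
and after these moves any two independent edges cross an even number of times. -/
def HasEvenDrawing {V : Type*} (G : SimpleGraph V) : Prop :=
  ∃ (T : V → V → ZMod 2) (φ : V → V → V → ZMod 2),
    (∀ x y, x ≠ y → T x y + T y x = 1) ∧
    ∀ a b c d, G.Adj a b → G.Adj c d → a ≠ c → a ≠ d → b ≠ c → b ≠ d →
      T a c + T a d + T b c + T b d = φ a c d + φ b c d + φ c a b + φ d a b

/-- The sum of `g` over the darts of a walk. -/
def SimpleGraph.Walk.dartSum {V : Type*} {G : SimpleGraph V} (g : V → V → ZMod 2) :
    ∀ {a b : V}, G.Walk a b → ZMod 2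
  | _, _, .nil => 0
  | a, _, .cons (v := v) _ p => g a v + p.dartSum g

section EvenDrawing

variable {V : Type*} {G : SimpleGraph V} {T : V → V → ZMod 2} {φ : V → V → V → ZMod 2}

lemma even_crossing_edge_walk
    (hφ : ∀ a b c d, G.Adj a b → G.Adj c d → a ≠ c → a ≠ d → b ≠ c → b ≠ d →
      T a c + T a d + T b c + T b d = φ a c d + φ b c d + φ c a b + φ d a b)
    {a b c d : V} (hab : G.Adj a b) (q : G.Walk c d) (ha : a ∉ q.support) (hb : b ∉ q.support) :
    T a c + T a d + T b c + T b d
      = q.dartSum (φ a) + q.dartSum (φ b) + φ c a b + φ d a b := by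
  induction q with
  | nil => simp only [Walk.dartSum]; grind
  | @cons c c' d hc q ih =>
    simp only [Walk.support_cons, List.mem_cons, not_or] at ha hb
    have hac' : a ≠ c' := fun h => ha.2 (h ▸ q.start_mem_support)
    have hbc' : b ≠ c' := fun h => hb.2 (h ▸ q.start_mem_support)
    have h₁ := hφ a b c c' hab hc ha.1 hac' hb.1 hbc'
    have h₂ := ih ha.2 hb.2
    simp only [Walk.dartSum]
    grind

lemma even_crossing_walk_walk
    (hφ : ∀ a b c d, G.Adj a b → G.Adj c d → a ≠ c → a ≠ d → b ≠ c → b ≠ d →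
      T a c + T a d + T b c + T b d = φ a c d + φ b c d + φ c a b + φ d a b)
    {a b c d : V} (p : G.Walk a b) (q : G.Walk c d) (hpq : ∀ v ∈ p.support, v ∉ q.support) :
    T a c + T a d + T b c + T b d
      = q.dartSum (φ a) + q.dartSum (φ b) + p.dartSum (φ c) + p.dartSum (φ d) := by
  induction p with
  | nil => simp only [Walk.dartSum]; grind
  | @cons a a' b ha p ih =>
    simp only [Walk.support_cons, List.mem_cons, forall_eq_or_imp] at hpq
    have h₁ := even_crossing_edge_walk hφ ha q hpq.1 (hpq.2 a' p.start_mem_support)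
    have h₂ := ih hpq.2
    simp only [Walk.dartSum]
    grind

lemma HasEvenDrawing.of_containsSubdivision {W : Type*} {H : SimpleGraph W}
    (hG : HasEvenDrawing G) (hGH : ContainsSubdivision G H) : HasEvenDrawing H := by
  classical
  obtain ⟨T, φ, hT, hφ⟩ := hG
  obtain ⟨f, hf, p, -, -, hp⟩ := hGH
  refine ⟨fun x y => T (f x) (f y),
    fun w a b => if h : H.Adj a b then (p h).dartSum (φ (f w)) else 0,
    fun x y hxy => hT _ _ (hf.ne hxy), fun a b c d hab hcd hac had hbc hbd => ?_⟩
  simp only [hab, hcd, dif_pos]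
  refine even_crossing_walk_walk hφ (p hab) (p hcd) fun v hv hv' => ?_
  have hne : s(a, b) ≠ s(c, d) := by simp [hac, had]
  obtain ⟨rfl | rfl, h | h⟩ := hp hab hcd hne v hv hv'
  exacts [hac (hf h), had (hf h), hbc (hf h), hbd (hf h)]

end EvenDrawing

lemma not_hasEvenDrawing_completeGraph_five :
    ¬ HasEvenDrawing (completeGraph (Fin 5)) := by
  rintro ⟨T, φ, hT, hφ⟩
  have key (a b c d : Fin 5) (hab : a ≠ b) (hcd : c ≠ d) := hφ a b c d hab hcd
  have e₁ (a b c d : Fin 5) (h : [a, b, c, d].Nodup) :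
      T a c + T a d + T b c + T b d + T a b + T a d + T c b + T c d
        + T a b + T a c + T d b + T d c =
      φ a c d + φ b c d + φ c a b + φ d a b + φ a b d + φ c b d + φ b a c + φ d a c
        + φ a b c + φ d b c + φ b a d + φ c a d := by
    simp only [List.nodup_cons, List.mem_cons, List.not_mem_nil, not_or] at h
    have h₁ := key a b c d (by grind) (by grind) (by grind) (by grind) (by grind) (by grind)
    have h₂ := key a c b d (by grind) (by grind) (by grind) (by grind) (by grind) (by grind)
    have h₃ := key a d b c (by grind) (by grind) (by grind) (by grind) (by grind) (by grind)
    linear_combination h₁ + h₂ + h₃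
  have h₀ := e₁ 1 2 3 4 (by decide)
  have h₁ := e₁ 0 2 3 4 (by decide)
  have h₂ := e₁ 0 1 3 4 (by decide)
  have h₃ := e₁ 0 1 2 4 (by decide)
  have h₄ := e₁ 0 1 2 3 (by decide)
  have t₁ := hT 1 2 (by decide)
  have t₂ := hT 1 3 (by decide)
  have t₃ := hT 2 3 (by decide)
  have t₄ := hT 2 4 (by decide)
  have t₅ := hT 3 4 (by decide)
  have t₆ := hT 1 4 (by decide)
  grind

lemma not_hasEvenDrawing_completeBipartiteGraph_three_three :
    ¬ HasEvenDrawing (completeBipartiteGraph (Fin 3) (Fin 3)) := by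
  rintro ⟨T, φ, hT, hφ⟩
  have key (a a' b b' : Fin 3) (ha : a ≠ a') (hb : b ≠ b') :=
    hφ (.inl a) (.inr b) (.inl a') (.inr b') (by simp) (by simp) (by simpa) (by simp) (by simp)
      (by simpa)
  have e (a a' : Fin 3) (ha : a ≠ a') :=
    congrArg₂ (· + ·) (congrArg₂ (· + ·)
      (congrArg₂ (· + ·) (key a a' 0 1 ha (by decide)) (key a a' 1 0 ha (by decide)))
      (congrArg₂ (· + ·) (key a a' 0 2 ha (by decide)) (key a a' 2 0 ha (by decide))))
      (congrArg₂ (· + ·) (key a a' 1 2 ha (by decide)) (key a a' 2 1 ha (by decide)))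
  have h₀ := e 0 1 (by decide)
  have h₁ := e 0 2 (by decide)
  have h₂ := e 1 2 (by decide)
  have t (a b : Fin 3) := hT (.inl a) (.inr b) (by simp)
  have t₀ := t 0 0
  have t₁ := t 0 1
  have t₂ := t 0 2
  have t₃ := t 1 0
  have t₄ := t 1 1
  have t₅ := t 1 2
  have t₆ := t 2 0
  have t₇ := t 2 1
  have t₈ := t 2 2
  have s₀ := hT (.inr 0) (.inr 1) (by simp)
  have s₁ := hT (.inr 0) (.inr 2) (by simp)
  have s₂ := hT (.inr 1) (.inr 2) (by simp)
  grind

lemma isPlanar_of_hasEvenDrawing {V : Type*} {G : SimpleGraph V} (hG : HasEvenDrawing G) :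
    IsPlanar G :=
  ⟨fun h => not_hasEvenDrawing_completeGraph_five (hG.of_containsSubdivision h),
    fun h => not_hasEvenDrawing_completeBipartiteGraph_three_three (hG.of_containsSubdivision h)⟩

section Functigraph

variable {n : ℕ} (f : Fin n → Fin n)

/-- The functigraph `C(Pₙ, f)`. -/
abbrev functigraph : SimpleGraph (Fin n ⊕ Fin n) :=
  ladderGraph n n (Finset.univ.image fun i => (i, f i))

@[simp] lemma functigraph_adj_inl_inl {i j : Fin n} :
    (functigraph f).Adj (.inl i) (.inl j) ↔ (i : ℕ) + 1 = j ∨ (j : ℕ) + 1 = i := by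
  simp only [ladderGraph, fromRel_adj, ladderRel]
  grind

@[simp] lemma functigraph_adj_inr_inr {i j : Fin n} :
    (functigraph f).Adj (.inr i) (.inr j) ↔ (i : ℕ) + 1 = j ∨ (j : ℕ) + 1 = i := by
  simp only [ladderGraph, fromRel_adj, ladderRel]
  grind

@[simp] lemma functigraph_adj_inl_inr {i j : Fin n} :
    (functigraph f).Adj (.inl i) (.inr j) ↔ f i = j := by
  simp [ladderGraph, ladderRel]

@[simp] lemma functigraph_adj_inr_inl {i j : Fin n} :
    (functigraph f).Adj (.inr j) (.inl i) ↔ f i = j := by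
  simp [ladderGraph, ladderRel]

/-- The quadrants around a point of the graph of `f`. -/
inductive Quadrant
  | lowerRight | upperRight | upperLeft | lowerLeft

/-- The point `(j, f j)` lies in the given open quadrant around `(i, f i)`. -/
def Quadrant.Mem (i j : Fin n) : Quadrant → Prop
  | lowerRight => i < j ∧ f j < f i
  | upperRight => i < j ∧ f i < f j
  | upperLeft => j < i ∧ f i < f j
  | lowerLeft => j < i ∧ f j < f i

open Classical in
/-- The vertices across which the cross edge at `uᵢ` is pulled when a quadrant around
`(i, f i)` is empty. -/
noncomputable def Quadrant.shift (i : Fin n) : Quadrant → Fin n ⊕ Fin n → ZMod 2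
  | lowerRight, .inl k => if i < k then 1 else 0
  | lowerLeft, .inl k => if i < k then 1 else 0
  | lowerLeft, .inr l => if l < f i then 1 else 0
  | upperLeft, .inr l => if f i < l then 1 else 0
  | _, _ => 0

lemma Quadrant.shift_inl_eq (i : Fin n) (q : Quadrant) {k k' : Fin n} (hk : i < k ↔ i < k') :
    q.shift f i (.inl k) = q.shift f i (.inl k') := by
  cases q <;> simp [shift, hk]

lemma Quadrant.shift_inr_eq (i : Fin n) (q : Quadrant) {l l' : Fin n} (hl : l < f i ↔ l' < f i)
    (hl' : f i < l ↔ f i < l') :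
    q.shift f i (.inr l) = q.shift f i (.inr l') := by
  cases q <;> simp [shift, hl, hl']

lemma Quadrant.shift_cross (q : Fin n → Quadrant) (hq : ∀ i j, ¬ (q i).Mem f i j) {i k : Fin n}
    (hik : i < k) (hf : f i ≠ f k) :
    (if f i < f k then (1 : ZMod 2) else 0) =
      (q k).shift f k (.inl i) + (q k).shift f k (.inr (f i)) +
        (q i).shift f i (.inl k) + (q i).shift f i (.inr (f k)) := by
  have h₁ := hq i k
  have h₂ := hq k i
  cases hi : q i <;> cases hk : q k <;> simp only [hi, hk, Mem, shift] at h₁ h₂ ⊢ <;> grind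

/-- The order of the vertices along the line: first all `uᵢ`, then all `vⱼ`. -/
def lineOrder : Fin n ⊕ Fin n → Fin n ⊕ Fin n → ZMod 2
  | .inl i, .inl j => if j < i then 1 else 0
  | .inr i, .inr j => if j < i then 1 else 0
  | .inl _, .inr _ => 0
  | .inr _, .inl _ => 1

lemma hasEvenDrawing_functigraph (q : Fin n → Quadrant) (hq : ∀ i j, ¬ (q i).Mem f i j) :
    HasEvenDrawing (functigraph f) := by
  refine ⟨lineOrder, fun v a b => match a, b with
    | .inl i, .inr _ => (q i).shift f i v
    | .inr _, .inl i => (q i).shift f i v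
    | _, _ => 0, ?_, ?_⟩
  · rintro (x | x) (y | y) h <;> simp [lineOrder] at h ⊢ <;> grind
  have hl (i : Fin n) {k k' : Fin n} (h : (k : ℕ) + 1 = k' ∨ (k' : ℕ) + 1 = k) (hk : i ≠ k)
      (hk' : i ≠ k') := (q i).shift_inl_eq f i (k := k) (k' := k') (by grind)
  have hr (i : Fin n) {k k' : Fin n} (h : (k : ℕ) + 1 = k' ∨ (k' : ℕ) + 1 = k) (hk : f i ≠ k)
      (hk' : f i ≠ k') :=
    (q i).shift_inr_eq f i (l := k) (l' := k') (by grind) (by grind)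
  have hc (i k : Fin n) (hik : i < k) (hf : f i ≠ f k) := Quadrant.shift_cross f q hq hik hf
  rintro (a | a) (b | b) (c | c) (d | d) hab hcd hac had hbc hbd <;>
    simp only [functigraph_adj_inl_inl, functigraph_adj_inr_inr, functigraph_adj_inl_inr,
      functigraph_adj_inr_inl, ne_eq, Sum.inl.injEq, Sum.inr.injEq] at hab hcd hac had hbc hbd <;>
    simp only [lineOrder] <;> grind

end Functigraph

lemma containsSubdivision_completeBipartiteGraph_s10 {V α β : Type*} {G : SimpleGraph V}
    {x : α → V} {y : β → V} (hx : Function.Injective x) (hy : Function.Injective y)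
    (hxy : ∀ a b, x a ≠ y b) (S : α → β → Set V)
    (hS : ∀ a b, ∃ w : G.Walk (x a) (y b), ∀ v ∈ w.support, v ∈ S a b)
    (hSx : ∀ a b a', x a' ∈ S a b → a' = a) (hSy : ∀ a b b', y b' ∈ S a b → b' = b)
    (o : V → α × β) (ho : ∀ a b, ∀ v ∈ S a b, v = x a ∨ v = y b ∨ o v = (a, b)) :
    ContainsSubdivision G (completeBipartiteGraph α β) := by
  classical
  let f : α ⊕ β → V := Sum.elim x y
  let S' : α ⊕ β → α ⊕ β → Set V
    | .inl a, .inr b => S a b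
    | .inr b, .inl a => S a b
    | _, _ => ∅
  have hwalk (s t : α ⊕ β) (h : (completeBipartiteGraph α β).Adj s t) :
      ∃ w : G.Walk (f s) (f t), w.IsPath ∧ ∀ v ∈ w.support, v ∈ S' s t := by
    rcases s with a | b <;> rcases t with a' | b' <;> simp at h
    · obtain ⟨w, hw⟩ := hS a b'
      exact ⟨w.bypass, w.bypass_isPath, fun v hv => hw v (w.support_bypass_subset_support hv)⟩
    · obtain ⟨w, hw⟩ := hS a' b
      exact ⟨w.reverse.bypass, w.reverse.bypass_isPath,
        fun v hv => hw v (by simpa using w.reverse.support_bypass_subset_support hv)⟩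
  have hend (s t w : α ⊕ β) (hw : f w ∈ S' s t) : w = s ∨ w = t := by
    rcases s with a | b <;> rcases t with a' | b' <;> rcases w with c | c <;>
      simp only [S', f, Sum.elim_inl, Sum.elim_inr, Set.mem_empty_iff_false] at hw <;> grind
  have hbranch (s t s' t' : α ⊕ β) (hne : s(s, t) ≠ s(s', t')) (v : V) (hv : v ∈ S' s t)
      (hv' : v ∈ S' s' t') : ∃ w, v = f w := by
    have (a b a' b') (h₁ : v ∈ S a b) (h₂ : v ∈ S a' b') (h : ¬ (a = a' ∧ b = b')) :
        ∃ w, v = f w := by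
      obtain rfl | rfl | h₁ := ho a b v h₁
      · exact ⟨.inl a, rfl⟩
      · exact ⟨.inr b, rfl⟩
      obtain rfl | rfl | h₂ := ho a' b' v h₂
      · exact ⟨.inl a', rfl⟩
      · exact ⟨.inr b', rfl⟩
      exact (h (Prod.ext_iff.1 (h₁.symm.trans h₂))).elim
    rcases s with a | b <;> rcases t with a' | b' <;> rcases s' with c | d <;>
      rcases t' with c' | d' <;>
      simp only [S', Set.mem_empty_iff_false] at hv hv' <;>
      exact this _ _ _ _ hv hv' (by rintro ⟨rfl, rfl⟩; simp [Sym2.eq_swap] at hne)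
  choose p hp hpS using hwalk
  refine ⟨f, ?_, p, hp, fun s t h w hw => hend s t w (hpS s t h _ hw), ?_⟩
  · rintro (a | b) (a' | b') h
    · exact congrArg _ (hx h)
    · exact (hxy _ _ h).elim
    · exact (hxy _ _ h.symm).elim
    · exact congrArg _ (hy h)
  · intro s t s' t' h h' hne v hv hv'
    obtain ⟨w, rfl⟩ := hbranch s t s' t' hne v (hpS _ _ _ _ hv) (hpS _ _ _ _ hv')
    exact ⟨(hend _ _ _ (hpS _ _ _ _ hv)).imp (congrArg f) (congrArg f),
      (hend _ _ _ (hpS _ _ _ _ hv')).imp (congrArg f) (congrArg f)⟩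

lemma exists_walk_of_adj_succ {V : Type*} {G : SimpleGraph V} {n : ℕ} (g : Fin n → V)
    (hg : ∀ i j : Fin n, (i : ℕ) + 1 = j → G.Adj (g i) (g j)) (i j : Fin n) :
    ∃ w : G.Walk (g i) (g j), ∀ v ∈ w.support, ∃ k ∈ Set.uIcc i j, v = g k := by
  have hle (d : ℕ) : ∀ i j : Fin n, (i : ℕ) + d = j →
      ∃ w : G.Walk (g i) (g j), ∀ v ∈ w.support, ∃ k ∈ Set.Icc i j, v = g k := by
    induction d with
    | zero =>
      intro i j h
      obtain rfl : i = j := Fin.ext h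
      exact ⟨.nil, by simp⟩
    | succ d ih =>
      intro i j h
      obtain ⟨w, hw⟩ := ih ⟨i + 1, by omega⟩ j (by simp; omega)
      refine ⟨.cons (hg i ⟨i + 1, by omega⟩ rfl) w, fun v hv => ?_⟩
      rw [Walk.support_cons, List.mem_cons] at hv
      obtain rfl | hv := hv
      · exact ⟨i, ⟨le_rfl, by rw [Fin.le_def]; omega⟩, rfl⟩
      · obtain ⟨k, ⟨hk, hk'⟩, rfl⟩ := hw v hv
        exact ⟨k, ⟨by rw [Fin.le_def] at hk ⊢; simp at hk; omega, hk'⟩, rfl⟩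
  rcases le_total i j with h | h
  · rw [Set.uIcc_of_le h]
    exact hle (j - i) i j (by rw [Fin.le_def] at h; omega)
  · rw [Set.uIcc_of_ge h]
    obtain ⟨w, hw⟩ := hle (i - j) j i (by rw [Fin.le_def] at h; omega)
    exact ⟨w.reverse, by simpa using hw⟩

section Functigraph

variable {n : ℕ} (f : Fin n → Fin n)

lemma exists_walk_inl (i j : Fin n) : ∃ w : (functigraph f).Walk (.inl i) (.inl j),
    ∀ v ∈ w.support, ∃ k ∈ Set.uIcc i j, v = .inl k :=
  exists_walk_of_adj_succ Sum.inl (fun i j h => by simp [h]) i j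

lemma exists_walk_inr (i j : Fin n) : ∃ w : (functigraph f).Walk (.inr i) (.inr j),
    ∀ v ∈ w.support, ∃ k ∈ Set.uIcc i j, v = .inr k :=
  exists_walk_of_adj_succ Sum.inr (fun i j h => by simp [h]) i j

lemma exists_walk_cross (i j k : Fin n) : ∃ w : (functigraph f).Walk (.inr k) (.inl i),
    ∀ v ∈ w.support, (∃ l ∈ Set.uIcc i j, v = .inl l) ∨ ∃ l ∈ Set.uIcc (f j) k, v = .inr l := by
  obtain ⟨p, hp⟩ := exists_walk_inr f k (f j)
  obtain ⟨q, hq⟩ := exists_walk_inl f j i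
  refine ⟨p.append (.cons (by simp) q), fun v hv => ?_⟩
  rw [Walk.mem_support_append_iff, Walk.support_cons, List.mem_cons] at hv
  rw [Set.uIcc_comm i, Set.uIcc_comm _ k]
  obtain hv | rfl | hv := hv
  exacts [.inr (hp v hv), .inr ⟨f j, by simp, rfl⟩, .inl (hq v hv)]

set_option maxHeartbeats 800000 in
lemma containsSubdivision_functigraph {i j₁ j₂ j₃ j₄ : Fin n} (h₁ : i < j₁ ∧ f j₁ < f i)
    (h₂ : i < j₂ ∧ f i < f j₂) (h₃ : j₃ < i ∧ f i < f j₃) (h₄ : j₄ < i ∧ f j₄ < f i) :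
    ContainsSubdivision (functigraph f) (completeBipartiteGraph (Fin 3) (Fin 3)) := by
  obtain ⟨a, ha₃, ha₄, ha⟩ : ∃ a, j₃ ≤ a ∧ j₄ ≤ a ∧ (a = j₃ ∨ a = j₄) :=
    ⟨max j₃ j₄, by simp, by simp, by grind⟩
  obtain ⟨b, hb₁, hb₂, hb⟩ : ∃ b, b ≤ j₁ ∧ b ≤ j₂ ∧ (b = j₁ ∨ b = j₂) :=
    ⟨min j₁ j₂, by simp, by simp, by grind⟩
  obtain ⟨c, hc₁, hc₄, hc⟩ : ∃ c, f j₁ ≤ c ∧ f j₄ ≤ c ∧ (c = f j₁ ∨ c = f j₄) :=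
    ⟨max (f j₁) (f j₄), by simp, by simp, by grind⟩
  obtain ⟨d, hd₂, hd₃, hd⟩ : ∃ d, d ≤ f j₂ ∧ d ≤ f j₃ ∧ (d = f j₂ ∨ d = f j₃) :=
    ⟨min (f j₂) (f j₃), by simp, by simp, by grind⟩
  have hj₁₂ : j₁ ≠ j₂ := by grind
  have hj₃₄ : j₃ ≠ j₄ := by grind
  let S : Fin 3 → Fin 3 → Set (Fin n ⊕ Fin n) := ![
    ![{.inl i, .inr (f i)}, {v | ∃ k ∈ Set.uIcc i a, v = .inl k},
      {v | ∃ k ∈ Set.uIcc i b, v = .inl k}],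
    ![{v | ∃ l ∈ Set.uIcc c (f i), v = .inr l},
      {v | (∃ k ∈ Set.uIcc a j₄, v = .inl k) ∨ ∃ l ∈ Set.uIcc (f j₄) c, v = .inr l},
      {v | (∃ k ∈ Set.uIcc b j₁, v = .inl k) ∨ ∃ l ∈ Set.uIcc (f j₁) c, v = .inr l}],
    ![{v | ∃ l ∈ Set.uIcc d (f i), v = .inr l},
      {v | (∃ k ∈ Set.uIcc a j₃, v = .inl k) ∨ ∃ l ∈ Set.uIcc (f j₃) d, v = .inr l},
      {v | (∃ k ∈ Set.uIcc b j₂, v = .inl k) ∨ ∃ l ∈ Set.uIcc (f j₂) d, v = .inr l}]]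
  let o : Fin n ⊕ Fin n → Fin 3 × Fin 3
    | .inl k =>
      if k < i then (if a < k then (0, 1) else if a = j₃ then (1, 1) else (2, 1))
      else (if k < b then (0, 2) else if b = j₁ then (2, 2) else (1, 2))
    | .inr l =>
      if l < f i then (if c < l then (1, 0) else if c = f j₁ then (1, 1) else (1, 2))
      else (if l < d then (2, 0) else if d = f j₂ then (2, 1) else (2, 2))
  refine containsSubdivision_completeBipartiteGraph_s10 (x := ![.inl i, .inr c, .inr d])
    (y := ![.inr (f i), .inl a, .inl b]) ?_ ?_ ?_ S ?_ ?_ ?_ o ?_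
  · intro s t h
    fin_cases s <;> fin_cases t <;> simp at h ⊢ <;> grind
  · intro s t h
    fin_cases s <;> fin_cases t <;> simp at h ⊢ <;> grind
  · intro s t
    fin_cases s <;> fin_cases t <;> simp <;> grind
  · intro s t
    fin_cases s <;> fin_cases t
    · exact ⟨.cons (by simp) .nil, by simp [S]⟩
    · exact exists_walk_inl f i a
    · exact exists_walk_inl f i b
    · exact exists_walk_inr f c (f i)
    · exact exists_walk_cross f a j₄ c
    · exact exists_walk_cross f b j₁ c
    · exact exists_walk_inr f d (f i)
    · exact exists_walk_cross f a j₃ d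
    · exact exists_walk_cross f b j₂ d
  · intro s t s' h
    fin_cases s <;> fin_cases t <;> fin_cases s' <;>
      simp only [S, Fin.zero_eta, Fin.mk_one, Fin.reduceFinMk, Matrix.cons_val] at h <;>
      simp [Set.mem_uIcc] at h ⊢ <;> clear S o <;> grind
  · intro s t s' h
    fin_cases s <;> fin_cases t <;> fin_cases s' <;>
      simp only [S, Fin.zero_eta, Fin.mk_one, Fin.reduceFinMk, Matrix.cons_val] at h <;>
      simp [Set.mem_uIcc] at h ⊢ <;> clear S o <;> grind
  · intro s t v h
    rcases v with v | v <;> fin_cases s <;> fin_cases t <;>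
      simp only [S, Fin.zero_eta, Fin.mk_one, Fin.reduceFinMk, Matrix.cons_val] at h <;>
      simp [Set.mem_uIcc] at h <;> simp [o] <;> clear S o <;> grind

end Functigraph

/-- **Planarity of functigraphs `C(Pₙ, f)`.**
The functigraph `C(Pₙ, f)` — the generalized (n,n)-ladder graph whose cross edges are
`u_i v_{f(i)}` for every `i` — is planar iff for each `i`, at least one of the four sets
`{j : i < j, f j < f i}`, `{j : i < j, f i < f j}`, `{j : j < i, f i < f j}`,
`{j : j < i, f j < f i}` is empty. -/
theorem functigraph_planar_iff (n : ℕ) (hn : 0 < n) (f : Fin n → Fin n) :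
    IsPlanar (ladderGraph n n (Finset.univ.image fun i => (i, f i))) ↔
      ∀ i : Fin n,
        {j : Fin n | i < j ∧ f j < f i} = (∅ : Set (Fin n)) ∨
        {j : Fin n | i < j ∧ f i < f j} = (∅ : Set (Fin n)) ∨
        {j : Fin n | j < i ∧ f i < f j} = (∅ : Set (Fin n)) ∨
        {j : Fin n | j < i ∧ f j < f i} = (∅ : Set (Fin n)) := by
  constructor
  · intro h i
    by_contra! hne
    obtain ⟨⟨j₁, h₁⟩, ⟨j₂, h₂⟩, ⟨j₃, h₃⟩, j₄, h₄⟩ := hne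
    exact h.2 (containsSubdivision_functigraph f h₁ h₂ h₃ h₄)
  · intro h
    have hq (i : Fin n) : ∃ q : Quadrant, ∀ j, ¬ q.Mem f i j := by
      simp only [Set.eq_empty_iff_forall_notMem] at h
      obtain h | h | h | h := h i
      exacts [⟨.lowerRight, h⟩, ⟨.upperRight, h⟩, ⟨.upperLeft, h⟩, ⟨.lowerLeft, h⟩]
    choose q hq using hq
    exact isPlanar_of_hasEvenDrawing (hasEvenDrawing_functigraph f q hq)
end
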